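/- arXiv:2209.07446 — 3 statements merged into one kernel-verified Lean document; each statement's English description precedes it below -/
import Mathlib

section
/- Let n ≥ 1 and let (X_t)_{t≥0} be a random sequence of [n]-valued random variables on a probability space (Ω, μ) such that almost surely, for every epoch index k ∈ ℕ, the map j ↦ X_{kn+j} (j = 0, 1, …, n−1) is a bijection of [n] (i.e. each epoch of length n visits every state exactly once, as in single or random shuffling). Let π be the uniform distribution on [n]. Then for every d ≥ 1 and every function g : [n] → ℝ^d, the asymptotic covariance matrix Σ(g) exists and equals the zero matrix: (1/t) E[Δ_t(g) Δ_t(g)^T] → 0 entrywise as t → ∞. -/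
open MeasureTheory Filter Matrix

lemma epoch_bound {n : ℕ} (hn : 1 ≤ n) (x : ℕ → Fin n)
    (hx : ∀ k : ℕ, Function.Bijective (fun j : Fin n => x (k * n + (j : ℕ))))
    (f : Fin n → ℝ) (t : ℕ) :
    |∑ s ∈ Finset.range t, (f (x s) - ∑ i, (1 / (n : ℝ)) * f i)| ≤
      n * ∑ i, |f i - ∑ i, (1 / (n : ℝ)) * f i| := by
  obtain ⟨h, hh⟩ : ∃ h : Fin n → ℝ, h = fun i => f i - ∑ i, (1 / (n : ℝ)) * f i := ⟨_, rfl⟩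
  have hn0 : (n : ℝ) ≠ 0 := by
    have : n ≠ 0 := by omega
    exact_mod_cast this
  have hsum : ∑ i, h i = 0 := by
    rw [hh, Finset.sum_sub_distrib, ← Finset.mul_sum]
    simp
    field_simp
    simp
  have hle : ∀ i, |h i| ≤ ∑ j, |h j| := fun i =>
    Finset.single_le_sum (f := fun j => |h j|) (fun j _ => abs_nonneg _) (Finset.mem_univ i)
  have hz : ∀ k : ℕ, ∑ s ∈ Finset.range (k * n), h (x s) = 0 := by
    intro k
    induction k with
    | zero => simp
    | succ k ih =>
      rw [Nat.succ_mul, Finset.sum_range_add, ih, zero_add,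
        Finset.sum_range (fun j => h (x (k * n + j)))]
      rw [← hsum]
      exact (hx k).sum_comp h
  have key : |∑ s ∈ Finset.range t, h (x s)| ≤ n * ∑ i, |h i| := by
    have ht : t = (t / n) * n + t % n := by
      rw [mul_comm]; exact (Nat.div_add_mod t n).symm
    rw [ht, Finset.sum_range_add, hz, zero_add]
    refine (Finset.abs_sum_le_sum_abs _ _).trans ?_
    refine (Finset.sum_le_card_nsmul _ _ _ (fun i _ => hle _)).trans ?_
    rw [nsmul_eq_mul, Finset.card_range]
    have : ((t % n : ℕ) : ℝ) ≤ n := by exact_mod_cast (Nat.mod_lt t hn).le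
    exact mul_le_mul_of_nonneg_right this (Finset.sum_nonneg fun _ _ => abs_nonneg _)
  rw [hh] at key
  exact key

/-- If almost surely each epoch of length `n` of the random sequence
`(X_t)` visits every state of `Fin n` exactly once (single or random shuffling), then with
`π` uniform, for every vector-valued `g` the asymptotic covariance matrix exists and is
zero: every entry of `(1/t) E[Δ_t(g) Δ_t(g)ᵀ]` tends to `0`. -/
theorem stmt_3 {n : ℕ} (hn : 1 ≤ n)
    {Ω : Type} [MeasurableSpace Ω] (μ : Measure Ω) [IsProbabilityMeasure μ]
    (X : ℕ → Ω → Fin n) (hmeas : ∀ t, Measurable (X t))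
    (hshuffle : ∀ᵐ ω ∂μ, ∀ k : ℕ,
      Function.Bijective (fun j : Fin n => X (k * n + (j : ℕ)) ω)) :
    ∀ (d : ℕ) (g : Fin n → Fin d → ℝ) (a b : Fin d),
      Tendsto (fun t : ℕ => (1 / (t : ℝ)) *
        ∫ ω, (∑ s ∈ Finset.range t, (g (X s ω) a - ∑ i, (1 / (n : ℝ)) * g i a)) *
             (∑ s ∈ Finset.range t, (g (X s ω) b - ∑ i, (1 / (n : ℝ)) * g i b)) ∂μ)
        atTop (nhds 0) := by
  intro d g a b
  have hb := fun c : Fin d => hshuffle.mono fun ω hω t =>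
    epoch_bound hn (fun s => X s ω) hω (fun i => g i c) t
  obtain ⟨A, hA⟩ : ∃ A : ℝ, A = n * ∑ i, |g i a - ∑ i, (1 / (n : ℝ)) * g i a| := ⟨_, rfl⟩
  obtain ⟨B, hB⟩ : ∃ B : ℝ, B = n * ∑ i, |g i b - ∑ i, (1 / (n : ℝ)) * g i b| := ⟨_, rfl⟩
  have hA0 : 0 ≤ A := by rw [hA]; positivity
  refine squeeze_zero_norm (a := fun t : ℕ => (1 / (t : ℝ)) * (A * B)) ?_ ?_
  · intro t
    rw [norm_mul, Real.norm_of_nonneg (by positivity : (0 : ℝ) ≤ 1 / (t : ℝ))]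
    refine mul_le_mul_of_nonneg_left ?_ (by positivity)
    refine (norm_integral_le_of_norm_le_const (C := A * B) ?_).trans ?_
    · filter_upwards [hb a, hb b] with ω h1 h2
      rw [norm_mul, Real.norm_eq_abs, Real.norm_eq_abs, hA, hB]
      exact mul_le_mul (h1 t) (h2 t) (abs_nonneg _) (hA ▸ hA0)
    · simp
  · simpa using (tendsto_one_div_atTop_nhds_zero_nat (𝕜 := ℝ)).mul_const (A * B)
end

section
/- Let A be a real symmetric positive definite d×d matrix and let γ be a real number with 0 < γ < 2/‖A‖₂, where ‖·‖₂ denotes the spectral (ℓ²-operator) norm. Let b : ℕ → ℝ^d be a bounded sequence whose Cesàro averages converge: (1/t)∑_{i=1}^{t} b_i → b̄ as t → ∞. Define the iterates θ_{t+1} = θ_t − γ(A θ_t − b_{t+1}) from an arbitrary initial point θ_0 ∈ ℝ^d. Then the averaged iterates converge to the minimizer: θ̄_t = (1/t)∑_{i=0}^{t−1} θ_i → A^{−1} b̄ as t → ∞. -/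
open MeasureTheory Filter Matrix

lemma aux_scalar_bdd (c β : ℕ → ℝ) (a K : ℝ) (ha : |a| < 1) (hβ : ∀ t, |β t| ≤ K)
    (hc : ∀ t, c (t + 1) = a * c t + β t) : ∃ M, ∀ t, |c t| ≤ M := by
  refine ⟨max |c 0| (K / (1 - |a|)), fun t => ?_⟩
  induction t with
  | zero => exact le_max_left _ _
  | succ t ih =>
    set M := max |c 0| (K / (1 - |a|)) with hM
    have h1 : K / (1 - |a|) ≤ M := le_max_right _ _
    rw [div_le_iff₀ (by linarith)] at h1
    rw [hc]
    calc |a * c t + β t| ≤ |a| * |c t| + |β t| := by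
          rw [← abs_mul]; exact abs_add_le _ _
      _ ≤ |a| * M + K := add_le_add (mul_le_mul_of_nonneg_left ih (abs_nonneg _)) (hβ t)
      _ ≤ M := by linarith

lemma aux_bdd {d : ℕ} (A : Matrix (Fin d) (Fin d) ℝ) (hA : A.PosDef)
    (γ : ℝ) (hγ0 : 0 < γ) (hγ2 : γ < 2 / ‖Matrix.toEuclideanCLM (𝕜 := ℝ) A‖)
    (b : ℕ → Fin d → ℝ) (C : ℝ) (hb : ∀ i, ‖b i‖ ≤ C)
    (θ : ℕ → Fin d → ℝ)
    (hθ : ∀ t, θ (t + 1) = θ t - γ • (A.mulVec (θ t) - b (t + 1))) (i : Fin d) :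
    ∃ M, ∀ t, |(hA.isHermitian.eigenvectorBasis i).ofLp ⬝ᵥ θ t| ≤ M := by
  set v : Fin d → ℝ := (hA.isHermitian.eigenvectorBasis i).ofLp with hv
  set l := hA.isHermitian.eigenvalues i with hl
  have hAv : A *ᵥ v = l • v := hA.isHermitian.mulVec_eigenvectorBasis i
  have hT : A.transpose = A := by simpa using hA.isHermitian.eq
  have hl0 : 0 < l := hA.eigenvalues_pos i
  have hln : l ≤ ‖Matrix.toEuclideanCLM (𝕜 := ℝ) A‖ := by
    have h := (Matrix.toEuclideanCLM (𝕜 := ℝ) A).le_opNorm (hA.isHermitian.eigenvectorBasis i)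
    have h2 : (Matrix.toEuclideanCLM (𝕜 := ℝ) A) (hA.isHermitian.eigenvectorBasis i)
        = l • hA.isHermitian.eigenvectorBasis i := by
      apply (WithLp.ofLp_injective 2)
      rw [Matrix.ofLp_toEuclideanCLM]
      exact hAv
    rw [h2, norm_smul, (hA.isHermitian.eigenvectorBasis).norm_eq_one i] at h
    simpa [abs_of_pos hl0] using h
  have hN : 0 < ‖Matrix.toEuclideanCLM (𝕜 := ℝ) A‖ := hl0.trans_le hln
  rw [lt_div_iff₀ hN] at hγ2
  have hγl : γ * l < 2 := lt_of_le_of_lt (mul_le_mul_of_nonneg_left hln hγ0.le) hγ2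
  have hpos : 0 < γ * l := mul_pos hγ0 hl0
  refine aux_scalar_bdd (fun t => v ⬝ᵥ θ t) (fun t => γ * (v ⬝ᵥ b (t + 1))) (1 - γ * l)
    (γ * ∑ j, |v j| * C) (abs_lt.2 ⟨by linarith, by linarith⟩) ?_ ?_
  · intro t
    rw [abs_mul, abs_of_pos hγ0]
    refine mul_le_mul_of_nonneg_left ?_ hγ0.le
    refine (Finset.abs_sum_le_sum_abs _ _).trans (Finset.sum_le_sum fun j _ => ?_)
    rw [abs_mul]
    exact mul_le_mul_of_nonneg_left ((norm_le_pi_norm (b (t+1)) j).trans (hb _)) (abs_nonneg _)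
  · intro t
    have h3 : v ⬝ᵥ (A *ᵥ θ t) = l * (v ⬝ᵥ θ t) := by
      rw [Matrix.dotProduct_mulVec, ← Matrix.mulVec_transpose, hT, hAv, smul_dotProduct,
        smul_eq_mul]
    simp only [hθ t, dotProduct_sub, dotProduct_smul, h3, smul_eq_mul]
    ring

lemma aux_small {d : ℕ} (A : Matrix (Fin d) (Fin d) ℝ) (hA : A.PosDef)
    (θ : ℕ → Fin d → ℝ)
    (h : ∀ i, ∃ M, ∀ t, |(hA.isHermitian.eigenvectorBasis i).ofLp ⬝ᵥ θ t| ≤ M) :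
    Tendsto (fun t : ℕ => (t : ℝ)⁻¹ • θ t) atTop (nhds 0) := by
  have hrep : ∀ t, θ t = ∑ i, ((hA.isHermitian.eigenvectorBasis i).ofLp ⬝ᵥ θ t) •
      (hA.isHermitian.eigenvectorBasis i).ofLp := by
    intro t
    have h1 := (hA.isHermitian.eigenvectorBasis).sum_repr' (WithLp.toLp 2 (θ t))
    have h2 := congrArg WithLp.ofLp h1
    rw [WithLp.ofLp_sum] at h2
    simpa [EuclideanSpace.inner_eq_star_dotProduct, dotProduct_comm] using h2.symm
  have h3 : Tendsto (fun t : ℕ => ∑ i, ((t : ℝ)⁻¹ *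
      ((hA.isHermitian.eigenvectorBasis i).ofLp ⬝ᵥ θ t)) •
      (hA.isHermitian.eigenvectorBasis i).ofLp) atTop
      (nhds (∑ i, (0 : ℝ) • (hA.isHermitian.eigenvectorBasis i).ofLp)) := by
    refine tendsto_finsetSum _ fun i _ => Tendsto.smul_const ?_ _
    obtain ⟨M, hM⟩ := h i
    have h4 : Tendsto (fun t : ℕ => (t : ℝ)⁻¹ * M) atTop (nhds 0) := by
      simpa using (tendsto_inv_atTop_nhds_zero_nat (𝕜 := ℝ)).mul_const M
    refine squeeze_zero_norm (fun t => ?_) h4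
    rw [norm_mul, norm_inv, Real.norm_natCast]
    exact mul_le_mul_of_nonneg_left (hM t) (by positivity)
  simp only [zero_smul, Finset.sum_const_zero] at h3
  refine h3.congr fun t => ?_
  conv_rhs => rw [hrep t]
  simp only [Finset.smul_sum, smul_smul]

/-- Deterministic core of constant step-size linear SGD convergence: for a
symmetric positive definite `A`, step size `0 < γ < 2/‖A‖₂` (spectral norm), and a bounded
sequence `b` whose Cesàro averages converge to `b̄`, the averaged iterates of
`θ_{t+1} = θ_t - γ (A θ_t - b_{t+1})` converge to `A⁻¹ b̄`. -/
theorem stmt_8 {d : ℕ} (A : Matrix (Fin d) (Fin d) ℝ) (hA : A.PosDef)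
    (γ : ℝ) (hγ0 : 0 < γ) (hγ2 : γ < 2 / ‖Matrix.toEuclideanCLM (𝕜 := ℝ) A‖)
    (b : ℕ → Fin d → ℝ) (C : ℝ) (hb : ∀ i, ‖b i‖ ≤ C)
    (bbar : Fin d → ℝ)
    (hces : Tendsto (fun t : ℕ => (t : ℝ)⁻¹ • ∑ i ∈ Finset.Icc 1 t, b i)
      atTop (nhds bbar))
    (θ : ℕ → Fin d → ℝ)
    (hθ : ∀ t, θ (t + 1) = θ t - γ • (A.mulVec (θ t) - b (t + 1))) :
    Tendsto (fun t : ℕ => (t : ℝ)⁻¹ • ∑ i ∈ Finset.range t, θ i)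
      atTop (nhds (A⁻¹.mulVec bbar)) := by
  have hs := aux_small A hA θ (aux_bdd A hA γ hγ0 hγ2 b C hb θ hθ)
  have hsum : ∀ t, γ • A *ᵥ (∑ i ∈ Finset.range t, θ i)
      = γ • (∑ i ∈ Finset.Icc 1 t, b i) - θ t + θ 0 := by
    intro t
    induction t with
    | zero => simp
    | succ t ih =>
      rw [Finset.sum_range_succ, Matrix.mulVec_add, smul_add, ih,
        Finset.sum_Icc_succ_top (by omega), hθ t]
      module
  have hdet : IsUnit A.det := hA.det_pos.ne'.isUnit
  have hS : ∀ t, ∑ i ∈ Finset.range t, θ i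
      = A⁻¹ *ᵥ ((∑ i ∈ Finset.Icc 1 t, b i) - γ⁻¹ • θ t + γ⁻¹ • θ 0) := by
    intro t
    have h1 : A *ᵥ (∑ i ∈ Finset.range t, θ i)
        = (∑ i ∈ Finset.Icc 1 t, b i) - γ⁻¹ • θ t + γ⁻¹ • θ 0 := by
      have h2 := congrArg (fun x => γ⁻¹ • x) (hsum t)
      simpa [smul_add, smul_sub, smul_smul, inv_mul_cancel₀ hγ0.ne'] using h2
    rw [← h1, Matrix.mulVec_mulVec, Matrix.nonsing_inv_mul _ hdet, Matrix.one_mulVec]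
  have h0 : Tendsto (fun t : ℕ => (t : ℝ)⁻¹ • θ 0) atTop (nhds 0) := by
    simpa using (tendsto_inv_atTop_nhds_zero_nat (𝕜 := ℝ)).smul_const (θ 0)
  have hlim := (hces.sub (hs.const_smul γ⁻¹)).add (h0.const_smul γ⁻¹)
  simp only [smul_zero, sub_zero, add_zero] at hlim
  have hcont : Continuous fun x : Fin d → ℝ => A⁻¹ *ᵥ x :=
    Continuous.matrix_mulVec continuous_const continuous_id
  refine ((hcont.tendsto bbar).comp hlim).congr fun t => ?_
  rw [hS t, ← Matrix.mulVec_smul]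
  simp only [Function.comp]
  congr 1
  module
end

section
/- Fix d ≥ 1 and define f : ℝ^d → ℝ (with the Euclidean norm) by f(x) = √(‖x‖² + 1). Then: (i) f is differentiable everywhere and its gradient is ∇f(x) = x / √(‖x‖² + 1); (ii) f attains its minimum value 1 at x = 0; and (iii) f fails the Polyak–Łojasiewicz inequality: for every μ > 0 there exists x ∈ ℝ^d with (1/2)‖∇f(x)‖² < μ·(f(x) − 1). -/
/-- For `f(x) = √(‖x‖² + 1)` on `ℝ^d` (`d ≥ 1`): (i) `f` has gradient
`x/√(‖x‖² + 1)` everywhere; (ii) `f` attains its minimum value `1` at `0`; (iii) `f` fails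
the Polyak–Łojasiewicz inequality for every `μ > 0`. -/
theorem stmt_12 {d : ℕ} (hd : 1 ≤ d) :
    (∀ x : EuclideanSpace ℝ (Fin d),
      HasGradientAt (fun y : EuclideanSpace ℝ (Fin d) => Real.sqrt (‖y‖ ^ 2 + 1))
        ((Real.sqrt (‖x‖ ^ 2 + 1))⁻¹ • x) x) ∧
    (Real.sqrt (‖(0 : EuclideanSpace ℝ (Fin d))‖ ^ 2 + 1) = 1 ∧
      ∀ x : EuclideanSpace ℝ (Fin d), 1 ≤ Real.sqrt (‖x‖ ^ 2 + 1)) ∧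
    (∀ μ : ℝ, 0 < μ → ∃ x : EuclideanSpace ℝ (Fin d),
      (1 / 2) * ‖(Real.sqrt (‖x‖ ^ 2 + 1))⁻¹ • x‖ ^ 2 <
        μ * (Real.sqrt (‖x‖ ^ 2 + 1) - 1)) := by
  refine ⟨fun x => ?_, ⟨by simp, fun x => ?_⟩, fun μ hμ => ?_⟩
  · have hpos : 0 < ‖x‖ ^ 2 + 1 := by positivity
    have h1 := (((hasStrictFDerivAt_norm_sq x).hasFDerivAt).add_const 1).sqrt hpos.ne'
    rw [hasGradientAt_iff_hasFDerivAt]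
    refine h1.congr_fderiv ?_
    ext y
    have hs : Real.sqrt (‖x‖ ^ 2 + 1) ≠ 0 := (Real.sqrt_pos.mpr hpos).ne'
    simp [inner_smul_left]
    field_simp
  · rw [Real.one_le_sqrt]
    nlinarith [sq_nonneg ‖x‖]
  · have ht : 0 < 1 + 1 / μ := by positivity
    refine ⟨EuclideanSpace.single (⟨0, hd⟩ : Fin d) (1 + 1 / μ), ?_⟩
    set x : EuclideanSpace ℝ (Fin d) := EuclideanSpace.single (⟨0, hd⟩ : Fin d) (1 + 1 / μ) with hx
    have hn : ‖x‖ = 1 + 1 / μ := by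
      rw [hx, EuclideanSpace.norm_single, Real.norm_of_nonneg ht.le]
    have hpos : 0 < ‖x‖ ^ 2 + 1 := by positivity
    have hge : ‖x‖ ≤ Real.sqrt (‖x‖ ^ 2 + 1) := Real.le_sqrt_of_sq_le (by linarith)
    have hR : 1 ≤ μ * (Real.sqrt (‖x‖ ^ 2 + 1) - 1) := by
      have h2 : 1 / μ ≤ Real.sqrt (‖x‖ ^ 2 + 1) - 1 := by linarith
      calc (1 : ℝ) = μ * (1 / μ) := by field_simp
        _ ≤ _ := mul_le_mul_of_nonneg_left h2 hμ.le
    have hL : ‖(Real.sqrt (‖x‖ ^ 2 + 1))⁻¹ • x‖ ^ 2 ≤ 1 := by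
      rw [norm_smul, mul_pow, norm_inv, Real.norm_of_nonneg (Real.sqrt_nonneg _), inv_pow,
        Real.sq_sqrt hpos.le, inv_mul_le_iff₀ hpos]
      linarith
    linarith
end
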